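/- Let g ∈ R be such that f₀ᵗ(g) ∈ R for every integer t ∈ ℤ (where f₀ᵗ denotes the t-th power of the automorphism f₀ in the automorphism group of G). Then R · g ⊆ R, i.e. x · g ∈ R for every x ∈ R. -/

import Mathlib

open Pointwise

/-- The solution of a discrete-time linear control system:
`phi f₀ b 0 x u = x`, `phi f₀ b (k+1) x u = b (u k) * f₀ (phi f₀ b k x u)`. -/
def phi {G : Type*} [Group G] {U : Type*} (f₀ : G ≃* G) (b : U → G) :
    ℕ → G → (ℕ → U) → G
  | 0, x, _ => x
  | k + 1, x, u => b (u k) * f₀ (phi f₀ b k x u)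

/-- The reachable set from `x` at time `k`. -/
def reach {G : Type*} [Group G] {U : Type*} (f₀ : G ≃* G) (b : U → G)
    (k : ℕ) (x : G) : Set G :=
  {y | ∃ u : ℕ → U, phi f₀ b k x u = y}

theorem phi_eq_phi_one_mul {G : Type*} [Group G] {U : Type*} (f₀ : MulAut G) (b : U → G)
    (k : ℕ) (x : G) (u : ℕ → U) : phi f₀ b k x u = phi f₀ b k 1 u * (f₀ ^ k) x := by
  induction k with
  | zero => simp [phi]
  | succ k ih => simp only [phi, ih, map_mul, pow_succ', MulAut.mul_apply, mul_assoc]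

theorem phi_congr {G : Type*} [Group G] {U : Type*} (f₀ : G ≃* G) (b : U → G)
    (k : ℕ) (x : G) {u v : ℕ → U} (h : ∀ i < k, u i = v i) :
    phi f₀ b k x u = phi f₀ b k x v := by
  induction k with
  | zero => rfl
  | succ k ih => simp only [phi, h k k.lt_succ_self, ih fun i hi => h i (hi.trans k.lt_succ_self)]

theorem phi_add {G : Type*} [Group G] {U : Type*} (f₀ : G ≃* G) (b : U → G)
    (m k : ℕ) (x : G) (u : ℕ → U) :
    phi f₀ b (m + k) x u = phi f₀ b k (phi f₀ b m x u) (fun i => u (m + i)) := by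
  induction k with
  | zero => rfl
  | succ k ih => exact congrArg (fun y => b (u (m + k)) * f₀ y) ih

/-- Concatenating controls: points reachable from reachable points are reachable. -/
theorem reach_trans {G : Type*} [Group G] {U : Type*} {f₀ : G ≃* G} {b : U → G}
    {m k : ℕ} {x y z : G} (hy : y ∈ reach f₀ b m x) (hz : z ∈ reach f₀ b k y) :
    z ∈ reach f₀ b (m + k) x := by
  obtain ⟨v, rfl⟩ := hy
  obtain ⟨u, rfl⟩ := hz
  refine ⟨fun i => if i < m then v i else u (i - m), ?_⟩
  rw [phi_add, phi_congr f₀ b m x (v := v) fun i hi => by simp [hi]]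
  simp

/-- if g ∈ R and f₀ᵗ(g) ∈ R for all t ∈ ℤ, then R · g ⊆ R. -/
theorem reach_mul_subset {G : Type*} [Group G] {U : Type*} [Zero U]
    (f₀ : MulAut G) (b : U → G) (hb : b 0 = 1) (g : G)
    (hg : g ∈ ⋃ k ≥ 1, reach f₀ b k 1)
    (hinv : ∀ t : ℤ, (f₀ ^ t) g ∈ ⋃ k ≥ 1, reach f₀ b k 1) :
    ∀ x ∈ ⋃ k ≥ 1, reach f₀ b k 1, x * g ∈ ⋃ k ≥ 1, reach f₀ b k 1 := by
  intro x hx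
  simp only [Set.mem_iUnion, exists_prop] at hx hinv ⊢
  obtain ⟨k, hk, u, rfl⟩ := hx
  obtain ⟨m, -, hm⟩ := hinv (-k)
  refine ⟨m + k, le_add_left hk, reach_trans hm ⟨u, ?_⟩⟩
  rw [phi_eq_phi_one_mul, ← MulAut.mul_apply, zpow_neg, zpow_natCast, mul_inv_cancel,
    MulAut.one_apply]
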